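/- Let (A, ·, ∗, D) be a special GDN-Poisson admissible algebra, i.e.: (A,·) is a commutative associative algebra with unit e, (A,∗) is a commutative associative algebra, D is linear, and the identities (x·y)∗z = x·(y∗z), D(x∗y) = (Dx)∗y + x∗(Dy), and D(x·y) = (Dx)·y + x·(Dy) − x·y·(De) hold. Define x ∘ y := x ∗ (Dy). Then (A, ·, ∘) is a GDN-Poisson algebra. -/

import Mathlib

/-- a special GDN-Poisson admissible algebra `(A, ·, ∗, D)` (here `·` is
the ring multiplication with unit `e = 1`, `star` is a second commutative associative
`k`-bilinear multiplication, and `D` is `k`-linear, with the three compatibility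
identities), equipped with `x ∘ y := x ∗ D y`, is a GDN-Poisson algebra. -/
theorem specialGDNPoissonAdmissible_isGDNPoisson {k A : Type*} [Field k] [CommRing A]
    [Algebra k A] (star : A →ₗ[k] A →ₗ[k] A) (D : A →ₗ[k] A)
    (hcomm : ∀ x y : A, star x y = star y x)
    (hassoc : ∀ x y z : A, star (star x y) z = star x (star y z))
    (hms : ∀ x y z : A, star (x * y) z = x * star y z)
    (hDs : ∀ x y : A, D (star x y) = star (D x) y + star x (D y))
    (hDm : ∀ x y : A, D (x * y) = D x * y + x * D y - x * y * D 1) :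
    (∀ x y z : A,
      star x (D (star y (D z))) - star (star x (D y)) (D z)
        = star y (D (star x (D z))) - star (star y (D x)) (D z)) ∧
    (∀ x y z : A, star (star x (D y)) (D z) = star (star x (D z)) (D y)) ∧
    (∀ x y z : A, star (x * y) (D z) = x * star y (D z)) ∧
    (∀ x y z : A,
      star x (D y) * z - star x (D (y * z)) = star y (D x) * z - star y (D (x * z))) := by
  have key : ∀ x y : A, star x y = x * y * star 1 1 := by
    intro x y
    have h1 := hms x 1 y
    have h2 := hms y 1 1
    rw [mul_one] at h1 h2
    rw [h1, hcomm 1 y, h2, mul_assoc]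
  refine ⟨?_, ?_, fun x y z => hms x y (D z), ?_⟩
  · intro x y z
    rw [hDs, hDs, map_add, map_add]
    obtain ⟨c, hc⟩ : ∃ c : A, ∀ x y : A, star x y = x * y * c := ⟨_, key⟩
    simp only [hc]
    ring
  · intro x y z
    rw [hassoc, hassoc, hcomm (D y)]
  · intro x y z
    rw [hDm, hDm, key x (D y), key y (D x), key x, key y]
    ring
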